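/- Let c be a composition with #c ≥ 2 parts, let P(c) denote c with a new part 1 prepended, and let I(c) denote c with its first part incremented by 1. If #c is odd, then Φ(P(c)) = P(Φ(c)) and Φ(I(c)) = I(Φ(c)); if #c is even, then Φ(P(c)) = I(Φ(c)) and Φ(I(c)) = P(Φ(c)). -/

import Mathlib

namespace Paper

/-- Helper for `Phi`, acting on the reversed composition after the first
(odd-position, kept) part has been emitted: the head part (at an odd position
`≥ 3` from the right in the original composition) gets incremented, the next
(even-position) part `y` is replaced by `y - 1` ones, and so on; if the list
runs out just after an even position, a `1` is emitted (this is the prepended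
`1` of the original composition). -/
def phiCont : List ℕ → List ℕ
  | [] => [1]
  | [z] => [z + 1]
  | z :: y :: rest => (z + 1) :: (List.replicate (y - 1) 1 ++ phiCont rest)

/-- `Phi` on the reversed composition: the part at position 1 (from the right)
is kept, the part `y` at position 2 is replaced by `y - 1` ones, and the rest is
handled by `phiCont`. -/
def phiRev : List ℕ → List ℕ
  | [] => []
  | [x] => [x]
  | x :: y :: rest => x :: (List.replicate (y - 1) 1 ++ phiCont rest)

/-- The map `Φ` on compositions: counting positions from the right end (the last
part has position 1), every part `x` at even position is replaced by `x - 1`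
ones and its left neighbour is incremented, a new part `1` being prepended when
the even-position part is the leftmost part. -/
def Phi (c : List ℕ) : List ℕ := (phiRev c.reverse).reverse

/-- Increment the first part of a sequence. -/
def incFirst : List ℕ → List ℕ
  | [] => [1]
  | x :: xs => (x + 1) :: xs


/-- Increment the last part of a sequence. -/
def incLast (l : List ℕ) : List ℕ := (incFirst l.reverse).reverse

lemma incLast_append (a : List ℕ) {l : List ℕ} (h : l ≠ []) :
    incLast (a ++ l) = a ++ incLast l := by
  obtain ⟨l, x, rfl⟩ := List.eq_nil_or_concat l |>.resolve_left h
  simp [incLast, incFirst]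

lemma incLast_cons (x : ℕ) {l : List ℕ} (h : l ≠ []) : incLast (x :: l) = x :: incLast l :=
  incLast_append [x] h

lemma phiCont_ne_nil (l : List ℕ) : phiCont l ≠ [] := by
  rcases l with _ | ⟨_, _ | ⟨_, _⟩⟩ <;> simp [phiCont]

lemma replicate_one_append_one {y : ℕ} (hy : 0 < y) :
    List.replicate y 1 ++ [1] = List.replicate (y - 1) 1 ++ [1, 1] := by
  obtain ⟨y, rfl⟩ := Nat.exists_eq_add_of_lt hy
  simp [List.replicate_succ']

lemma phiCont_append_one (l : List ℕ) :
    phiCont (l ++ [1]) = if Odd l.length then phiCont l ++ [1] else incLast (phiCont l) := by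
  induction l using phiCont.induct with
  | case1 => simp [phiCont, incLast, incFirst]
  | case2 z => simp [phiCont]
  | case3 z y rest ih =>
    simp only [List.cons_append, phiCont, ih, List.length_cons, Nat.odd_add_one, not_not]
    split_ifs
    · simp
    · rw [incLast_cons _ (by simp [phiCont_ne_nil]), incLast_append _ (phiCont_ne_nil _)]

lemma phiCont_incLast (l : List ℕ) (hl : l ≠ []) (hpos : ∀ x ∈ l, 0 < x) :
    phiCont (incLast l) = if Odd l.length then incLast (phiCont l) else phiCont l ++ [1] := by
  induction l using phiCont.induct with
  | case1 => exact absurd rfl hl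
  | case2 z => simp [phiCont, incLast, incFirst]
  | case3 z y rest ih =>
    rcases eq_or_ne rest [] with rfl | hr
    · simpa [phiCont, incLast, incFirst, show ¬ Odd 2 by decide] using
        replicate_one_append_one (hpos y (by simp))
    · rw [incLast_cons _ (by simp), incLast_cons _ hr]
      simp only [phiCont, ih hr fun x hx => hpos x (by simp [hx]), List.length_cons,
        Nat.odd_add_one, not_not]
      split_ifs
      · rw [incLast_cons _ (by simp [phiCont_ne_nil]), incLast_append _ (phiCont_ne_nil _)]
      · simp

lemma phiRev_append_one {l : List ℕ} (hl : 2 ≤ l.length) :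
    phiRev (l ++ [1]) = if Odd l.length then phiRev l ++ [1] else incLast (phiRev l) := by
  rcases l with _ | ⟨x, _ | ⟨y, rest⟩⟩
  · simp at hl
  · simp at hl
  simp only [List.cons_append, phiRev, phiCont_append_one, List.length_cons, Nat.odd_add_one,
    not_not]
  split_ifs
  · simp
  · rw [incLast_cons _ (by simp [phiCont_ne_nil]), incLast_append _ (phiCont_ne_nil _)]

lemma phiRev_incLast {l : List ℕ} (hl : 2 ≤ l.length) (hpos : ∀ x ∈ l, 0 < x) :
    phiRev (incLast l) = if Odd l.length then incLast (phiRev l) else phiRev l ++ [1] := by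
  rcases l with _ | ⟨x, _ | ⟨y, rest⟩⟩
  · simp at hl
  · simp at hl
  rcases eq_or_ne rest [] with rfl | hr
  · simpa [phiRev, phiCont, incLast, incFirst, show ¬ Odd 2 by decide] using
      replicate_one_append_one (hpos y (by simp))
  rw [incLast_cons _ (by simp), incLast_cons _ hr]
  simp only [phiRev, phiCont_incLast rest hr fun x hx => hpos x (by simp [hx]),
    List.length_cons, Nat.odd_add_one, not_not]
  split_ifs
  · rw [incLast_cons _ (by simp [phiCont_ne_nil]), incLast_append _ (phiCont_ne_nil _)]
  · simp

/-- For a composition `c` with at least two parts, with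
`P(c) = 1 :: c` and `I(c)` incrementing the first part: if `#c` is odd then
`Φ ∘ P = P ∘ Φ` and `Φ ∘ I = I ∘ Φ` at `c`, while if `#c` is even then
`Φ ∘ P = I ∘ Φ` and `Φ ∘ I = P ∘ Φ` at `c`. -/
theorem stmt_5 (c : List ℕ) (hpos : ∀ x ∈ c, 0 < x) (hlen : 2 ≤ c.length) :
    (Odd c.length →
      Phi (1 :: c) = 1 :: Phi c ∧ Phi (incFirst c) = incFirst (Phi c)) ∧
    (Even c.length →
      Phi (1 :: c) = incFirst (Phi c) ∧ Phi (incFirst c) = 1 :: Phi c) := by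
  have hP : Phi (1 :: c) = if Odd c.length then 1 :: Phi c else incFirst (Phi c) := by
    simp only [Phi, List.reverse_cons, phiRev_append_one (l := c.reverse) (by simpa using hlen),
      List.length_reverse]
    split_ifs <;> simp [incLast]
  have hI : Phi (incFirst c) = if Odd c.length then incFirst (Phi c) else 1 :: Phi c := by
    have h := phiRev_incLast (l := c.reverse) (by simpa using hlen) (by simpa using hpos)
    simp only [incLast, List.reverse_reverse, List.length_reverse] at h
    rw [Phi, h]
    split_ifs <;> simp [Phi]
  refine ⟨fun h => ?_, fun h => ?_⟩
  · simp [hP, hI, h]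
  · simp [hP, hI, Nat.not_odd_iff_even.2 h]

end Paper
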